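/- Let L be a domain and let E be a locally compact quasisober topological space. Every L-valued 𝒬-smooth saturated maxitive measure on the Borel σ-algebra ℬ of E is weakly outer-continuous. -/

import Mathlib

open Set

universe u v

section OrderDefs
variable {L : Type u} [PartialOrder L]

/-- A filtered (nonempty, downward directed) subset of a poset. -/
def DirFiltered (F : Set L) : Prop :=
  F.Nonempty ∧ ∀ r ∈ F, ∀ s ∈ F, ∃ t ∈ F, t ≤ r ∧ t ≤ s

/-- A filter of a poset: a filtered upper set. -/
def OrdFilter (F : Set L) : Prop :=
  DirFiltered F ∧ ∀ r ∈ F, ∀ s : L, r ≤ s → s ∈ F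

/-- Every filter has an infimum. -/
def FilteredComplete (L : Type u) [PartialOrder L] : Prop :=
  ∀ F : Set L, OrdFilter F → ∃ i : L, IsGLB F i

/-- `s` is way-above `r`: for every filter `F` with an infimum below `r`, `s ∈ F`. -/
def WayAbove (s r : L) : Prop :=
  ∀ F : Set L, OrdFilter F → ∀ i : L, IsGLB F i → i ≤ r → s ∈ F

/-- The poset is continuous: for every `r`, the set of elements way-above `r`
is a filter whose infimum is `r`. -/
def ContinuousPoset (L : Type u) [PartialOrder L] : Prop :=
  ∀ r : L, OrdFilter {s : L | WayAbove s r} ∧ IsGLB {s : L | WayAbove s r} r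

/-- Conditional completeness: every nonempty set bounded above has a supremum. -/
def CondComplete (L : Type u) [PartialOrder L] : Prop :=
  ∀ S : Set L, S.Nonempty → BddAbove S → ∃ m : L, IsLUB S m

end OrderDefs

/-- A domain: a filtered-complete continuous poset with a least element. -/
def DomainPoset (L : Type u) [PartialOrder L] [OrderBot L] : Prop :=
  FilteredComplete L ∧ ContinuousPoset L

section TopDefs
variable {E : Type v} [TopologicalSpace E]

/-- The saturation of a set: intersection of all open sets containing it. -/
def satur (A : Set E) : Set E := ⋂₀ {G : Set E | IsOpen G ∧ A ⊆ G}

/-- A set is saturated if it is an intersection of open sets. -/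
def IsSatur (A : Set E) : Prop :=
  ∃ 𝒢 : Set (Set E), (∀ G ∈ 𝒢, IsOpen G) ∧ A = ⋂₀ 𝒢

/-- The collection 𝒬 of compact saturated subsets. -/
def CompactSat (E : Type v) [TopologicalSpace E] : Set (Set E) :=
  {A : Set E | IsCompact A ∧ IsSatur A}

/-- The Borel σ-algebra generated by open sets and compact saturated sets. -/
def BorelM (E : Type v) [TopologicalSpace E] : MeasurableSpace E :=
  MeasurableSpace.generateFrom ({A : Set E | IsOpen A} ∪ CompactSat E)

/-- Borel subsets for the σ-algebra generated by opens and compact saturated sets. -/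
def IsBorelSet (B : Set E) : Prop := @MeasurableSet E (BorelM E) B

/-- The collection 𝒦 of compact Borel subsets. -/
def CompactBorel (E : Type v) [TopologicalSpace E] : Set (Set E) :=
  {A : Set E | IsBorelSet A ∧ IsCompact A}

/-- `[x]` : the compact Borel set `↑{x} ∩ closure {x}`. -/
def ptClass (x : E) : Set E := satur {x} ∩ closure {x}

end TopDefs

section MeasDefs
variable {L : Type u} {E : Type v} [PartialOrder L] [OrderBot L] [TopologicalSpace E]

/-- An L-valued maxitive measure on the Borel σ-algebra. -/
def Maxitive (ν : Set E → L) : Prop :=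
  ν ∅ = ⊥ ∧ ∀ 𝒞 : Set (Set E), 𝒞.Finite → (∀ B ∈ 𝒞, IsBorelSet B) →
    IsLUB (ν '' 𝒞) (ν (⋃₀ 𝒞))

/-- σ-maxitivity. -/
def SigmaMaxitive (ν : Set E → L) : Prop :=
  Maxitive ν ∧ ∀ 𝒞 : Set (Set E), 𝒞.Countable → (∀ B ∈ 𝒞, IsBorelSet B) →
    IsLUB (ν '' 𝒞) (ν (⋃₀ 𝒞))

/-- Complete maxitivity. -/
def CompletelyMaxitive (ν : Set E → L) : Prop :=
  Maxitive ν ∧ ∀ 𝒞 : Set (Set E), (∀ B ∈ 𝒞, IsBorelSet B) → IsBorelSet (⋃₀ 𝒞) →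
    IsLUB (ν '' 𝒞) (ν (⋃₀ 𝒞))

/-- The set `{ν G : G open, G ⊇ B}`. -/
def outerVals (ν : Set E → L) (B : Set E) : Set L :=
  {l : L | ∃ G : Set E, IsOpen G ∧ B ⊆ G ∧ ν G = l}

/-- `νp` is the map `ν⁺ : B ↦ inf {ν G : G open, G ⊇ B}` on Borel sets. -/
def IsNuPlus (ν νp : Set E → L) : Prop :=
  ∀ B : Set E, IsBorelSet B → IsGLB (outerVals ν B) (νp B)

/-- Outer-continuity. -/
def OuterContinuous (ν : Set E → L) : Prop :=
  ∀ B : Set E, IsBorelSet B → IsGLB (outerVals ν B) (ν B)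

/-- Inner-continuity. -/
def InnerContinuous (ν : Set E → L) : Prop :=
  ∀ B : Set E, IsBorelSet B →
    IsLUB {l : L | ∃ K : Set E, IsBorelSet K ∧ IsCompact K ∧ K ⊆ B ∧ ν (satur K) = l} (ν B)

/-- Regularity: inner- and outer-continuity. -/
def RegularMeasure (ν : Set E → L) : Prop :=
  InnerContinuous ν ∧ OuterContinuous ν

/-- Weak outer-continuity: `ν K = ν⁺ K` for every compact Borel `K`. -/
def WeaklyOuterContinuous (ν : Set E → L) : Prop :=
  ∀ K : Set E, IsBorelSet K → IsCompact K → IsGLB (outerVals ν K) (ν K)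

/-- Weak inner-continuity (relative to a given `ν⁺ = νp`). -/
def WeaklyInnerContinuous (ν νp : Set E → L) : Prop :=
  ∀ G : Set E, IsOpen G →
    IsLUB {l : L | ∃ K : Set E, IsBorelSet K ∧ IsCompact K ∧ K ⊆ G ∧ νp K = l} (ν G)

/-- 𝒜-smoothness. -/
def SmoothWrt (ν : Set E → L) (𝒜 : Set (Set E)) : Prop :=
  ∀ 𝒟 : Set (Set E), 𝒟.Nonempty → 𝒟 ⊆ 𝒜 → DirectedOn (· ⊇ ·) 𝒟 →
    IsGLB (ν '' 𝒟) (ν (⋂₀ 𝒟))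

/-- Saturation of a maxitive measure: `ν K = ν (↑K)` for compact Borel `K`. -/
def SaturatedMeasure (ν : Set E → L) : Prop :=
  ∀ K : Set E, IsBorelSet K → IsCompact K → ν K = ν (satur K)

/-- Tightness: `inf {ν (E ∖ K) : K compact Borel} = 0`. -/
def TightMeasure (ν : Set E → L) : Prop :=
  IsGLB {l : L | ∃ K : Set E, IsBorelSet K ∧ IsCompact K ∧ ν Kᶜ = l} (⊥ : L)

/-- `c` is a cardinal density of `ν`. -/
def IsCardinalDensity (ν : Set E → L) (c : E → L) : Prop :=
  ∀ B : Set E, IsBorelSet B → IsLUB (c '' B) (ν B)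

/-- Upper semicontinuity of a map into the poset. -/
def UscMap (c : E → L) : Prop := ∀ t : L, IsOpen {x : E | WayAbove t (c x)}

/-- Upper compactness of a map into the poset. -/
def UpperCompactMap (c : E → L) : Prop :=
  ∀ t : L, WayAbove t (⊥ : L) → IsCompact {x : E | ¬ WayAbove t (c x)}

/-- Continuity from above along decreasing sequences of Borel sets. -/
def ContinuousFromAbove (ν : Set E → L) : Prop :=
  ∀ B : ℕ → Set E, (∀ n, IsBorelSet (B n)) → (∀ n, B (n + 1) ⊆ B n) →
    IsGLB (Set.range fun n => ν (B n)) (ν (⋂ n, B n))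

/-- An optimal measure: a σ-maxitive measure continuous from above. -/
def OptimalMeasure (ν : Set E → L) : Prop :=
  SigmaMaxitive ν ∧ ContinuousFromAbove ν

/-- `flo` is the regular part `⌊ν⌋` (relative to `νp = ν⁺`):
`⌊ν⌋(B) = sup {ν⁺(K) : K compact Borel, K ⊆ B}`. -/
def RegPartRel (νp flo : Set E → L) : Prop :=
  ∀ B : Set E, IsBorelSet B →
    IsLUB {l : L | ∃ K : Set E, IsBorelSet K ∧ IsCompact K ∧ K ⊆ B ∧ νp K = l} (flo B)

end MeasDefs

section Saturation
variable {E : Type v} [TopologicalSpace E]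

lemma subset_satur (A : Set E) : A ⊆ satur A :=
  subset_sInter fun _ hG => hG.2

lemma satur_subset_of_isOpen {A G : Set E} (hG : IsOpen G) (h : A ⊆ G) : satur A ⊆ G :=
  sInter_subset_of_mem ⟨hG, h⟩

lemma isSatur_satur (A : Set E) : IsSatur (satur A) :=
  ⟨{G : Set E | IsOpen G ∧ A ⊆ G}, fun _ hG => hG.1, rfl⟩

lemma IsSatur.satur_subset {A B : Set E} (hB : IsSatur B) (h : A ⊆ B) : satur A ⊆ B := by
  obtain ⟨𝒢, ho, rfl⟩ := hB
  exact subset_sInter fun G hG =>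
    satur_subset_of_isOpen (ho G hG) (h.trans (sInter_subset_of_mem hG))

lemma IsCompact.satur {A : Set E} (hA : IsCompact A) : IsCompact (satur A) := by
  refine isCompact_of_finite_subcover fun U hU hAU => ?_
  obtain ⟨t, ht⟩ := hA.elim_finite_subcover U hU ((subset_satur A).trans hAU)
  exact ⟨t, satur_subset_of_isOpen (isOpen_biUnion fun i _ => hU i) ht⟩

lemma satur_mem_compactSat {A : Set E} (hA : IsCompact A) : satur A ∈ CompactSat E :=
  ⟨hA.satur, isSatur_satur A⟩

lemma isBorelSet_of_isOpen {G : Set E} (hG : IsOpen G) : IsBorelSet G :=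
  MeasurableSpace.measurableSet_generateFrom (Or.inl hG)

lemma isBorelSet_of_mem_compactSat {Q : Set E} (hQ : Q ∈ CompactSat E) : IsBorelSet Q :=
  MeasurableSpace.measurableSet_generateFrom (Or.inr hQ)

/-- In a locally compact space, every compact set inside an open set `G` is in the interior of
some compact saturated subset of `G`. -/
lemma exists_compactSat_between [LocallyCompactSpace E] {K G : Set E} (hK : IsCompact K)
    (hG : IsOpen G) (h : K ⊆ G) : ∃ Q ∈ CompactSat E, K ⊆ interior Q ∧ Q ⊆ G := by
  obtain ⟨C, hC, hKC, hCG⟩ := exists_compact_between hK hG h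
  exact ⟨satur C, satur_mem_compactSat hC, hKC.trans (interior_mono (subset_satur C)),
    satur_subset_of_isOpen hG hCG⟩

lemma sInter_compactSat_nhds [LocallyCompactSpace E] {K : Set E} (hK : IsCompact K) :
    ⋂₀ {Q ∈ CompactSat E | K ⊆ interior Q} = satur K := by
  refine Subset.antisymm (subset_sInter fun G hG => ?_) (subset_sInter fun Q hQ =>
    hQ.1.2.satur_subset (hQ.2.trans interior_subset))
  obtain ⟨Q, hQ, hKQ, hQG⟩ := exists_compactSat_between hK hG.1 hG.2
  have hmem : Q ∈ {Q ∈ CompactSat E | K ⊆ interior Q} := ⟨hQ, hKQ⟩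
  exact (sInter_subset_of_mem hmem).trans hQG

lemma directedOn_compactSat_nhds [LocallyCompactSpace E] {K : Set E} (hK : IsCompact K) :
    DirectedOn (· ⊇ ·) {Q ∈ CompactSat E | K ⊆ interior Q} := by
  intro Q₁ hQ₁ Q₂ hQ₂
  obtain ⟨Q, hQ, hKQ, hsub⟩ := exists_compactSat_between hK
    (isOpen_interior.inter isOpen_interior) (subset_inter hQ₁.2 hQ₂.2)
  exact ⟨Q, ⟨hQ, hKQ⟩, (hsub.trans inter_subset_left).trans interior_subset,
    (hsub.trans inter_subset_right).trans interior_subset⟩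

end Saturation

lemma Maxitive.mono {L : Type u} {E : Type v} [PartialOrder L] [OrderBot L] [TopologicalSpace E]
    {ν : Set E → L} (hν : Maxitive ν) {A B : Set E} (hA : IsBorelSet A) (hB : IsBorelSet B)
    (h : A ⊆ B) : ν A ≤ ν B := by
  have hlub := hν.2 {A, B} (toFinite _) (by rintro C (rfl | rfl) <;> assumption)
  rw [sUnion_pair, union_eq_right.mpr h] at hlub
  exact hlub.1 (mem_image_of_mem ν (mem_insert A {B}))

/-- on a locally compact quasisober space, every 𝒬-smooth saturated
maxitive measure is weakly outer-continuous. -/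
theorem stmt7 {L : Type u} {E : Type v} [PartialOrder L] [OrderBot L]
    [TopologicalSpace E] [QuasiSober E] [LocallyCompactSpace E] (hL : DomainPoset L)
    (ν : Set E → L) (hν : Maxitive ν)
    (hQ : SmoothWrt ν (CompactSat E)) (hsat : SaturatedMeasure ν) :
    WeaklyOuterContinuous ν := by
  intro K hKB hK
  refine ⟨?_, fun b hb => ?_⟩
  · rintro _ ⟨G, hG, hKG, rfl⟩
    exact hν.mono hKB (isBorelSet_of_isOpen hG) hKG
  · obtain ⟨Q₀, hQ₀, hKQ₀, -⟩ := exists_compactSat_between hK isOpen_univ (subset_univ K)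
    have hglb := hQ {Q ∈ CompactSat E | K ⊆ interior Q} ⟨Q₀, hQ₀, hKQ₀⟩ (fun _ h => h.1)
      (directedOn_compactSat_nhds hK)
    rw [sInter_compactSat_nhds hK, ← hsat K hKB hK] at hglb
    refine hglb.2 ?_
    rintro _ ⟨Q, ⟨hQc, hKQ⟩, rfl⟩
    exact (hb ⟨interior Q, isOpen_interior, hKQ, rfl⟩).trans
      (hν.mono (isBorelSet_of_isOpen isOpen_interior) (isBorelSet_of_mem_compactSat hQc)
        interior_subset)
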